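/- arXiv:1604.07839 — 5 statements merged into one kernel-verified Lean document; each statement's English description precedes it below -/
import Mathlib

section
/- Let β : ℝ → ℝ be a twice continuously differentiable, even, non-negative, convex function with β(0) = 0 whose second derivative β'' is non-increasing on [0, ∞). Then for every r ∈ ℝ and every α ≥ 1, β(α r) ≤ α² β(r). -/
/-- If `β : ℝ → ℝ` is a twice continuously differentiable, even,
non-negative, convex function with `β 0 = 0` whose second derivative is non-increasing
on `[0, ∞)`, then for every `r ∈ ℝ` and every `α ≥ 1`, `β (α r) ≤ α² β(r)`. -/
theorem stmt_4 (β : ℝ → ℝ) (hC2 : ContDiff ℝ 2 β) (heven : ∀ r, β (-r) = β r)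
    (hnonneg : ∀ r, 0 ≤ β r) (hconv : ConvexOn ℝ Set.univ β) (h0 : β 0 = 0)
    (hanti : AntitoneOn (deriv (deriv β)) (Set.Ici 0)) :
    ∀ r α : ℝ, 1 ≤ α → β (α * r) ≤ α ^ 2 * β r := by
  have hd1 : Differentiable ℝ β := hC2.differentiable (by norm_num)
  have hC1 : ContDiff ℝ 1 (deriv β) := by
    have h : ContDiff ℝ (1 + 1) β := by
      have e : (1 + 1 : WithTop ℕ∞) = 2 := by norm_num
      rw [e]; exact hC2
    exact (contDiff_succ_iff_deriv.1 h).2.2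
  have hd2 : Differentiable ℝ (deriv β) := hC1.differentiable (by norm_num)
  have hb0 : deriv β 0 = 0 := by
    apply IsLocalMin.deriv_eq_zero
    exact Filter.Eventually.of_forall (fun x => by rw [h0]; exact hnonneg x)
  have key : ∀ r α : ℝ, 0 ≤ r → 1 ≤ α → β (α * r) ≤ α ^ 2 * β r := by
    intro r α hr hα
    have hlin : ∀ x : ℝ, HasDerivAt (fun y : ℝ => α * y) α x := fun x => by
      simpa using (hasDerivAt_id x).const_mul α
    have hg : ∀ x, HasDerivAt (fun y => α ^ 2 * β y - β (α * y))
        (α ^ 2 * deriv β x - deriv β (α * x) * α) x := fun x =>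
      ((hd1 x).hasDerivAt.const_mul _).sub ((hd1 (α * x)).hasDerivAt.comp x (hlin x))
    have hg' : ∀ x, HasDerivAt (fun y => α ^ 2 * deriv β y - deriv β (α * y) * α)
        (α ^ 2 * deriv (deriv β) x - deriv (deriv β) (α * x) * α * α) x := fun x =>
      ((hd2 x).hasDerivAt.const_mul _).sub
        (((hd2 (α * x)).hasDerivAt.comp x (hlin x)).mul_const α)
    have m1 : MonotoneOn (fun y => α ^ 2 * deriv β y - deriv β (α * y) * α) (Set.Ici 0) := by
      apply monotoneOn_of_deriv_nonneg (convex_Ici 0)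
      · exact fun x _ => (hg' x).continuousAt.continuousWithinAt
      · exact fun x _ => (hg' x).differentiableAt.differentiableWithinAt
      · intro x hx
        rw [interior_Ici] at hx
        have hx0 : (0:ℝ) < x := hx
        rw [(hg' x).deriv]
        have hle : x ≤ α * x := by nlinarith
        have := hanti (Set.mem_Ici.2 hx0.le) (Set.mem_Ici.2 (hx0.le.trans hle)) hle
        nlinarith [mul_nonneg (sq_nonneg α) (sub_nonneg.2 this)]
    have m2 : MonotoneOn (fun y => α ^ 2 * β y - β (α * y)) (Set.Ici 0) := by
      apply monotoneOn_of_deriv_nonneg (convex_Ici 0)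
      · exact fun x _ => (hg x).continuousAt.continuousWithinAt
      · exact fun x _ => (hg x).differentiableAt.differentiableWithinAt
      · intro x hx
        rw [interior_Ici] at hx
        have hx0 : (0:ℝ) < x := hx
        rw [(hg x).deriv]
        have := m1 (Set.mem_Ici.2 le_rfl) (Set.mem_Ici.2 hx0.le) hx0.le
        simpa [hb0] using this
    have := m2 (Set.mem_Ici.2 le_rfl) (Set.mem_Ici.2 hr) hr
    simpa [h0] using this
  intro r α hα
  rcases le_total 0 r with hr | hr
  · exact key r α hr hα
  · have := key (-r) α (by linarith) hα
    rwa [mul_neg, heven, heven] at this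
end

section
/- Let f : ℝ → ℝ be twice continuously differentiable with bounded second derivative. Then for every ξ > 0 and every u ∈ ℝ, the function v ↦ f^{β_ξ}(u,v) − f^{β_ξ}(v,u) is differentiable on ℝ, its derivative at v equals ∫_u^v (β_ξ'(u−v) − β_ξ'(s−v)) f''(s) ds, and this derivative satisfies |∂_v (f^{β_ξ}(u,v) − f^{β_ξ}(v,u))| ≤ 2 ξ ‖f''‖_∞ for all u, v ∈ ℝ. -/
open intervalIntegral

/-- The rescaled entropy function `β_ξ(r) = ξ β(r/ξ)`. -/
noncomputable def betaXi (β : ℝ → ℝ) (ξ : ℝ) : ℝ → ℝ := fun r => ξ * β (r / ξ)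

/-- The entropy flux `f^{β_ξ}(a,b) := ∫_b^a β_ξ'(r − b) f'(r) dr`. -/
noncomputable def fluxBeta (β : ℝ → ℝ) (ξ : ℝ) (f : ℝ → ℝ) (a b : ℝ) : ℝ :=
  ∫ r in b..a, deriv (betaXi β ξ) (r - b) * deriv f r

lemma aux_deriv (b g g' : ℝ → ℝ) (M : ℝ) (hb : Continuous b) (hb1 : ∀ r, |b r| ≤ 1)
    (hg : ∀ x, HasDerivAt g (g' x) x) (hg' : Continuous g') (hM : ∀ x, |g' x| ≤ M) (u v : ℝ) :
    HasDerivAt (fun w => ∫ r in w..u, b (r - w) * g r)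
      (-(b (u - v) * g u) + ∫ r in v..u, b (r - v) * g' r) v := by
  have hgc : Continuous g := continuous_iff_continuousAt.2 fun x => (hg x).continuousAt
  have hM0 : 0 ≤ M := (abs_nonneg _).trans (hM 0)
  have hci : ∀ w x y, IntervalIntegrable (fun t => b t * g (t + w)) MeasureTheory.volume x y :=
    fun w x y => (by fun_prop : Continuous (fun t => b t * g (t + w))).intervalIntegrable _ _
  have e : (fun w => ∫ r in w..u, b (r - w) * g r) = fun w =>
      ((∫ t in (0:ℝ)..(u - v), b t * g (t + w)) + ∫ t in (u - v)..(u - w), b t * g (t + v)) +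
        ∫ t in (u - v)..(u - w), b t * (g (t + w) - g (t + v)) := by
    funext w
    have h1 := intervalIntegral.integral_comp_sub_right (a := w) (b := u)
      (fun t => b t * g (t + w)) w
    simp only [sub_add_cancel, sub_self] at h1
    rw [h1, add_assoc, ← intervalIntegral.integral_add (hci v _ _)
      ((by fun_prop : Continuous
        (fun t => b t * (g (t + w) - g (t + v)))).intervalIntegrable _ _),
      ← intervalIntegral.integral_add_adjacent_intervals (hci w 0 (u - v)) (hci w (u-v) (u-w))]
    congr 1
    apply intervalIntegral.integral_congr
    intro t _
    simp only
    ring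
  rw [e]
  have d1 : HasDerivAt (fun w => ∫ t in (0:ℝ)..(u - v), b t * g (t + w))
      (∫ t in (0:ℝ)..(u - v), b t * g' (t + v)) v := by
    refine (intervalIntegral.hasDerivAt_integral_of_dominated_loc_of_deriv_le
      (F := fun w t => b t * g (t + w)) (F' := fun w t => b t * g' (t + w)) (bound := fun _ => M)
      (s := Set.univ) Filter.univ_mem ?_ (hci v _ _) ?_ ?_ ?_ ?_).2
    · exact Filter.Eventually.of_forall fun w =>
        (by fun_prop : Continuous (fun t => b t * g (t + w))).aestronglyMeasurable
    · exact (by fun_prop : Continuous (fun t => b t * g' (t + v))).aestronglyMeasurable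
    · refine Filter.Eventually.of_forall fun t _ x _ => ?_
      rw [Real.norm_eq_abs, abs_mul]
      calc _ ≤ 1 * M := mul_le_mul (hb1 _) (hM _) (abs_nonneg _) zero_le_one
        _ = M := one_mul _
    · exact intervalIntegrable_const
    · refine Filter.Eventually.of_forall fun t _ x _ => ?_
      exact ((hg (t + x)).comp_const_add t x).const_mul (b t)
  have d2 : HasDerivAt (fun w => ∫ t in (u - v)..(u - w), b t * g (t + v))
      (-(b (u - v) * g u)) v := by
    have hc : Continuous (fun t => b t * g (t + v)) := by fun_prop
    have h := intervalIntegral.integral_hasDerivAt_right (hci v (u - v) (u - v))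
      (hc.stronglyMeasurableAtFilter _ _) (hc.continuousAt)
    have h2 := HasDerivAt.comp_const_sub u v h
    simpa using h2
  have d3 : HasDerivAt (fun w => ∫ t in (u - v)..(u - w), b t * (g (t + w) - g (t + v))) 0 v := by
    have hL : ∀ x y, |g y - g x| ≤ M * |y - x| := fun x y => by
      have := Convex.norm_image_sub_le_of_norm_hasDerivWithin_le (f := g) (f' := g') (C := M)
        (s := Set.univ) (x := x) (y := y) (fun x _ => (hg x).hasDerivWithinAt)
        (fun x _ => hM x) convex_univ trivial trivial
      simpa using this
    have hO : (fun w => ∫ t in (u - v)..(u - w), b t * (g (t + w) - g (t + v)))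
        =O[nhds v] fun w => ‖w - v‖ ^ 2 := by
      refine Asymptotics.IsBigO.of_bound M (Filter.Eventually.of_forall fun w => ?_)
      have := intervalIntegral.norm_integral_le_of_norm_le_const (a := u - v) (b := u - w)
        (f := fun t => b t * (g (t + w) - g (t + v))) (C := M * |w - v|) (fun t _ => by
          rw [Real.norm_eq_abs, abs_mul]
          have h := hL (t + v) (t + w)
          rw [add_sub_add_left_eq_sub] at h
          calc _ ≤ 1 * (M * |w - v|) := mul_le_mul (hb1 _) h (abs_nonneg _) zero_le_one
            _ = _ := one_mul _)
      refine this.trans (le_of_eq ?_)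
      rw [show u - w - (u - v) = -(w - v) by ring, abs_neg]
      simp only [Real.norm_eq_abs, abs_pow, abs_abs]
      ring
    have := (hO.hasFDerivAt (by norm_num)).hasDerivAt
    simpa using this
  have h1 := intervalIntegral.integral_comp_sub_right (a := v) (b := u)
      (fun t => b t * g' (t + v)) v
  simp only [sub_add_cancel, sub_self] at h1
  rw [h1]
  refine ((d1.add d2).add d3).congr_deriv ?_
  ring

lemma aux_split (h : ℝ → ℝ) (hc : Continuous h) (u v m C ξ : ℝ) (hC : 0 ≤ C)
    (h1 : ∀ s ∈ Set.uIoc u m, h s = 0) (h2 : ∀ s, |h s| ≤ C) (hm : |v - m| ≤ ξ) :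
    |∫ s in u..v, h s| ≤ C * ξ := by
  rw [← intervalIntegral.integral_add_adjacent_intervals (hc.intervalIntegrable u m)
    (hc.intervalIntegrable m v), intervalIntegral.integral_zero_ae
      (Filter.Eventually.of_forall h1), zero_add]
  exact (intervalIntegral.norm_integral_le_of_norm_le_const (f := h) (fun s _ => h2 s)).trans
    (mul_le_mul_of_nonneg_left hm hC)

/-- Let `f : ℝ → ℝ` be `C²` with second derivative bounded by `M`. Then
for every `ξ > 0` and every `u`, the function `v ↦ f^{β_ξ}(u,v) − f^{β_ξ}(v,u)` is
differentiable on `ℝ`, its derivative at `v` equals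
`∫_u^v (β_ξ'(u−v) − β_ξ'(s−v)) f''(s) ds`, and this derivative has absolute value at most
`2 ξ ‖f''‖_∞`. -/
theorem stmt_7 (β : ℝ → ℝ) (hsmooth : ContDiff ℝ (⊤ : ℕ∞) β) (h0 : β 0 = 0)
    (heven : ∀ r, β (-r) = β r) (hconv : ∀ r, 0 ≤ deriv (deriv β) r)
    (hd1 : ∀ r, |deriv β r| ≤ 1)
    (hup : ∀ r : ℝ, 1 ≤ r → deriv β r = 1)
    (hdown : ∀ r : ℝ, r ≤ -1 → deriv β r = -1)
    (f : ℝ → ℝ) (hf : ContDiff ℝ 2 f)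
    (M : ℝ) (hM : ∀ x, |deriv (deriv f) x| ≤ M)
    (ξ : ℝ) (hξ : 0 < ξ) (u v : ℝ) :
    HasDerivAt (fun w => fluxBeta β ξ f u w - fluxBeta β ξ f w u)
      (∫ s in u..v, (deriv (betaXi β ξ) (u - v) - deriv (betaXi β ξ) (s - v)) *
        deriv (deriv f) s) v ∧
    |∫ s in u..v, (deriv (betaXi β ξ) (u - v) - deriv (betaXi β ξ) (s - v)) *
        deriv (deriv f) s| ≤ 2 * ξ * M := by
  have hbd : ∀ r, deriv (betaXi β ξ) r = deriv β (r / ξ) := by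
    intro r
    have hd : DifferentiableAt ℝ β (r / ξ) := (hsmooth.differentiable (by simp)) _
    have := ((hd.hasDerivAt.comp r ((hasDerivAt_id r).div_const ξ)).const_mul ξ).deriv
    have e : betaXi β ξ = fun y => ξ * (β ∘ fun x => id x / ξ) y := rfl
    rw [e, this]
    field_simp
  have hβc : Continuous (deriv β) := hsmooth.continuous_deriv (by simp)
  have hbc : Continuous (deriv (betaXi β ξ)) := by
    rw [funext hbd]; fun_prop
  have hb1 : ∀ r, |deriv (betaXi β ξ) r| ≤ 1 := fun r => by rw [hbd]; exact hd1 _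
  have hodd : ∀ r, deriv (betaXi β ξ) (-r) = - deriv (betaXi β ξ) r := fun r => by
    rw [hbd, hbd, neg_div]
    have h1 : deriv (fun x => β (-x)) (r / ξ) = deriv β (r / ξ) := by
      rw [funext heven]
    rw [deriv_comp_neg] at h1
    linarith
  have hbup : ∀ r, ξ ≤ r → deriv (betaXi β ξ) r = 1 := fun r hr => by
    rw [hbd]; exact hup _ ((one_le_div hξ).2 hr)
  have hbdn : ∀ r, r ≤ -ξ → deriv (betaXi β ξ) r = -1 := fun r hr => by
    rw [← neg_neg r, hodd, hbup (-r) (by linarith)]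
  have hf1 : ContDiff ℝ 1 (deriv f) := ((contDiff_succ_iff_deriv (n := 1)).1 hf).2.2
  have hg : ∀ x, HasDerivAt (deriv f) (deriv (deriv f) x) x := fun x =>
    (hf1.differentiable (by simp) x).hasDerivAt
  have hgc : Continuous (deriv f) := hf1.continuous
  have hg'c : Continuous (deriv (deriv f)) := hf1.continuous_deriv (by simp)
  have hM0 : 0 ≤ M := (abs_nonneg _).trans (hM 0)
  simp only [fluxBeta]
  generalize deriv (betaXi β ξ) = b at *
  generalize deriv (deriv f) = g' at *
  generalize deriv f = g at *
  constructor
  · have d1 := aux_deriv b g g' M hbc hb1 hg hg'c hM u v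
    have hc : Continuous (fun r => b (r - u) * g r) := by fun_prop
    have d2 : HasDerivAt (fun w => ∫ r in u..w, b (r - u) * g r) (b (v - u) * g v) v :=
      intervalIntegral.integral_hasDerivAt_right (hc.intervalIntegrable _ _)
        (hc.stronglyMeasurableAtFilter _ _) hc.continuousAt
    refine (d1.sub d2).congr_deriv ?_
    symm
    have i1 : ∫ s in u..v, g' s = g v - g u :=
      intervalIntegral.integral_eq_sub_of_hasDerivAt (fun x _ => hg x)
        (hg'c.intervalIntegrable _ _)
    simp only [sub_mul]
    rw [intervalIntegral.integral_sub
      ((by fun_prop : Continuous fun s => b (u - v) * g' s).intervalIntegrable _ _)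
      ((by fun_prop : Continuous fun s => b (s - v) * g' s).intervalIntegrable _ _),
      intervalIntegral.integral_const_mul, i1, intervalIntegral.integral_symm u v,
      ← neg_sub u v, hodd]
    ring
  · have hc : Continuous (fun s => (b (u - v) - b (s - v)) * g' s) := by fun_prop
    have h2 : ∀ s, |(b (u - v) - b (s - v)) * g' s| ≤ 2 * M := fun s => by
      rw [abs_mul]
      refine mul_le_mul ?_ (hM s) (abs_nonneg _) (by norm_num)
      have := abs_sub (b (u - v)) (b (s - v))
      linarith [hb1 (u - v), hb1 (s - v)]
    rw [show 2 * ξ * M = 2 * M * ξ by ring]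
    rcases le_total u v with huv | huv
    · refine aux_split _ hc u v (max u (v - ξ)) _ ξ (by positivity) ?_ h2 ?_
      · intro s hs
        rw [Set.uIoc_of_le (le_max_left _ _)] at hs
        have h3 : s ≤ v - ξ := (le_max_iff.1 hs.2).resolve_left (not_le.2 hs.1)
        have h4 := hs.1
        rw [hbdn (u - v) (by linarith), hbdn (s - v) (by linarith)]
        ring
      · rw [abs_of_nonneg (sub_nonneg.2 (max_le huv (by linarith)))]
        linarith [le_max_right u (v - ξ)]
    · refine aux_split _ hc u v (min u (v + ξ)) _ ξ (by positivity) ?_ h2 ?_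
      · intro s hs
        rw [Set.uIoc_of_ge (min_le_left _ _)] at hs
        have h3 : v + ξ ≤ s := by
          rcases min_lt_iff.1 hs.1 with h | h
          · exact absurd hs.2 (not_le.2 h)
          · exact h.le
        have h4 := hs.2
        rw [hbup (u - v) (by linarith), hbup (s - v) (by linarith)]
        ring
      · rw [abs_of_nonpos (sub_nonpos.2 (le_min huv (by linarith)))]
        linarith [min_le_right u (v + ξ)]
end

section
/- Let A, B : ℝ → ℝ be continuously differentiable with A' ≥ 0 and B' ≥ 0, with A' and B' bounded, and suppose B' is Lipschitz continuous with constant L. Then for every ξ > 0 and all u, v ∈ ℝ, | ∫_v^u β_ξ''(τ − v) ( √(A'(τ)) − √(B'(v)) )² dτ | ≤ 4 ( ‖A' − B'‖_∞ + L ξ ). -/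
open intervalIntegral

/-- Let `A, B : ℝ → ℝ` be `C¹` with `A' ≥ 0`, `B' ≥ 0`, with `A'` and
`B'` bounded, `B'` Lipschitz with constant `L`, and `‖A' − B'‖_∞ ≤ M`. Then for every
`ξ > 0` and all `u, v`,
`|∫_v^u β_ξ''(τ − v) (√(A'(τ)) − √(B'(v)))² dτ| ≤ 4 (‖A' − B'‖_∞ + L ξ)`. -/
theorem stmt_10 (β : ℝ → ℝ) (hsmooth : ContDiff ℝ (⊤ : ℕ∞) β) (h0 : β 0 = 0)
    (heven : ∀ r, β (-r) = β r) (hconv : ∀ r, 0 ≤ deriv (deriv β) r)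
    (hd1 : ∀ r, |deriv β r| ≤ 1)
    (hup : ∀ r : ℝ, 1 ≤ r → deriv β r = 1)
    (hdown : ∀ r : ℝ, r ≤ -1 → deriv β r = -1)
    (A B : ℝ → ℝ) (hA : ContDiff ℝ 1 A) (hB : ContDiff ℝ 1 B)
    (hA' : ∀ x, 0 ≤ deriv A x) (hB' : ∀ x, 0 ≤ deriv B x)
    (hA'bd : ∃ C, ∀ x, deriv A x ≤ C) (hB'bd : ∃ C, ∀ x, deriv B x ≤ C)
    (L : ℝ) (hL : ∀ x y, |deriv B x - deriv B y| ≤ L * |x - y|)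
    (M : ℝ) (hM : ∀ x, |deriv A x - deriv B x| ≤ M)
    (ξ : ℝ) (hξ : 0 < ξ) (u v : ℝ) :
    |∫ τ in v..u, deriv (deriv (betaXi β ξ)) (τ - v) *
        (Real.sqrt (deriv A τ) - Real.sqrt (deriv B v)) ^ 2| ≤ 4 * (M + L * ξ) := by
  have hβ : Differentiable ℝ β := hsmooth.differentiable (by simp)
  have hβ2 : ContDiff ℝ 1 (deriv β) := by
    have h2 : ContDiff ℝ (1 + 1) β := hsmooth.of_le (by norm_cast)
    exact (contDiff_succ_iff_deriv.1 h2).2.2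
  have hβd : Differentiable ℝ (deriv β) := hβ2.differentiable (by simp)
  have hβc : Continuous (deriv (deriv β)) := hβ2.continuous_deriv (by simp)
  have hdiv : ∀ r, HasDerivAt (fun r : ℝ => r / ξ) (1 / ξ) r := fun r =>
    (hasDerivAt_id r).div_const ξ
  have e1 : deriv (betaXi β ξ) = fun r => deriv β (r / ξ) := by
    funext r
    have h := (((hβ (r / ξ)).hasDerivAt.comp r (hdiv r)).const_mul ξ)
    have h' : HasDerivAt (betaXi β ξ) (ξ * (deriv β (r / ξ) * (1 / ξ))) r := h
    rw [h'.deriv]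
    field_simp
  have e2 : ∀ r, HasDerivAt (fun r => deriv β (r / ξ)) (deriv (deriv β) (r / ξ) * (1 / ξ)) r :=
    fun r => HasDerivAt.comp (h₂ := deriv β) r (hβd (r / ξ)).hasDerivAt (hdiv r)
  have e3 : ∀ r, deriv (deriv (betaXi β ξ)) r = deriv (deriv β) (r / ξ) * (1 / ξ) := by
    intro r
    rw [e1]
    exact (e2 r).deriv
  have hM0 : 0 ≤ M := (abs_nonneg _).trans (hM 0)
  have hL0 : 0 ≤ L := by
    have := (abs_nonneg _).trans (hL 1 0)
    simpa using this
  have hz : ∀ r : ℝ, 1 < |r| → deriv (deriv β) r = 0 := by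
    intro r hr
    rcases lt_abs.1 hr with h | h
    · have : deriv β =ᶠ[nhds r] fun _ => (1 : ℝ) := by
        filter_upwards [Ioi_mem_nhds h] with x hx
        exact hup x (le_of_lt hx)
      rw [this.deriv_eq]; simp
    · have : deriv β =ᶠ[nhds r] fun _ => (-1 : ℝ) := by
        filter_upwards [Iio_mem_nhds (show r < -1 by linarith)] with x hx
        exact hdown x (le_of_lt hx)
      rw [this.deriv_eq]; simp
  have hsq : ∀ a b : ℝ, 0 ≤ a → 0 ≤ b → (Real.sqrt a - Real.sqrt b) ^ 2 ≤ |a - b| := by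
    intro a b ha hb
    have h1 := Real.sq_sqrt ha
    have h2 := Real.sq_sqrt hb
    have h3 := Real.sqrt_nonneg a
    have h4 := Real.sqrt_nonneg b
    rcases le_total (Real.sqrt a) (Real.sqrt b) with h | h
    · have := neg_le_abs (a - b)
      nlinarith
    · have := le_abs_self (a - b)
      nlinarith
  have hK : 0 ≤ M + L * ξ := by positivity
  have hpt : ∀ τ, ‖deriv (deriv (betaXi β ξ)) (τ - v) *
        (Real.sqrt (deriv A τ) - Real.sqrt (deriv B v)) ^ 2‖ ≤
        deriv (deriv β) ((τ - v) / ξ) * (1 / ξ) * (M + L * ξ) := by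
    intro τ
    have hn : 0 ≤ deriv (deriv β) ((τ - v) / ξ) * (1 / ξ) :=
      mul_nonneg (hconv _) (by positivity)
    rw [e3, Real.norm_of_nonneg (mul_nonneg hn (sq_nonneg _))]
    by_cases hr : 1 < |(τ - v) / ξ|
    · simp [hz _ hr]
    · apply mul_le_mul_of_nonneg_left _ hn
      rw [not_lt, abs_div, abs_of_pos hξ, div_le_one hξ] at hr
      have a1 := hsq _ _ (hA' τ) (hB' v)
      have a2 := abs_sub_le (deriv A τ) (deriv B τ) (deriv B v)
      have a3 := hM τ
      have a4 := hL τ v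
      have a5 := mul_le_mul_of_nonneg_left hr hL0
      linarith
  have hgc : Continuous fun τ => deriv (deriv β) ((τ - v) / ξ) * (1 / ξ) := by fun_prop
  have hint : ∫ τ in v..u, deriv (deriv β) ((τ - v) / ξ) * (1 / ξ) =
      deriv β ((u - v) / ξ) - deriv β ((v - v) / ξ) := by
    refine integral_eq_sub_of_hasDerivAt (f := fun τ => deriv β ((τ - v) / ξ)) ?_
      (hgc.intervalIntegrable _ _)
    intro τ _
    exact (e2 (τ - v)).comp_sub_const τ v
  have hmain := norm_integral_le_abs_of_norm_le (μ := MeasureTheory.volume) (a := v) (b := u)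
    (Filter.Eventually.of_forall hpt)
    ((hgc.mul continuous_const).intervalIntegrable _ _)
  rw [integral_mul_const, hint, abs_mul, abs_of_nonneg hK, Real.norm_eq_abs] at hmain
  refine hmain.trans (mul_le_mul_of_nonneg_right ?_ hK)
  have b1 := abs_le.1 (hd1 ((u - v) / ξ))
  have b2 := abs_le.1 (hd1 ((v - v) / ξ))
  rw [abs_le]
  constructor <;> linarith [b1.1, b1.2, b2.1, b2.2]
end

section
/- Let A : ℝ → ℝ be continuously differentiable with A' ≥ 0, and suppose there is a constant K ≥ 0 such that |√(A'(τ)) − √(A'(σ))| ≤ K |τ − σ|^{2/3} for all τ, σ ∈ ℝ. Then for every ξ > 0 and all u, v ∈ ℝ, | ∫_u^v ∫_σ^u β_ξ''(τ − σ) ( √(A'(τ)) − √(A'(σ)) )² dτ dσ | ≤ 2 K² ξ^{4/3} |u − v|. -/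
open intervalIntegral

/-- Let `A : ℝ → ℝ` be `C¹` with `A' ≥ 0` and suppose
`|√(A'(τ)) − √(A'(σ))| ≤ K |τ − σ|^{2/3}` for all `τ, σ`. Then for every `ξ > 0` and all
`u, v`,
`|∫_u^v ∫_σ^u β_ξ''(τ − σ) (√(A'(τ)) − √(A'(σ)))² dτ dσ| ≤ 2 K² ξ^{4/3} |u − v|`. -/
theorem stmt_11 (β : ℝ → ℝ) (hsmooth : ContDiff ℝ (⊤ : ℕ∞) β) (h0 : β 0 = 0)
    (heven : ∀ r, β (-r) = β r) (hconv : ∀ r, 0 ≤ deriv (deriv β) r)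
    (hd1 : ∀ r, |deriv β r| ≤ 1)
    (hup : ∀ r : ℝ, 1 ≤ r → deriv β r = 1)
    (hdown : ∀ r : ℝ, r ≤ -1 → deriv β r = -1)
    (A : ℝ → ℝ) (hA : ContDiff ℝ 1 A) (hA' : ∀ x, 0 ≤ deriv A x)
    (K : ℝ) (hK : 0 ≤ K)
    (hmod : ∀ τ σ : ℝ,
      |Real.sqrt (deriv A τ) - Real.sqrt (deriv A σ)| ≤ K * |τ - σ| ^ ((2 : ℝ) / 3))
    (ξ : ℝ) (hξ : 0 < ξ) (u v : ℝ) :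
    |∫ σ in u..v, ∫ τ in σ..u, deriv (deriv (betaXi β ξ)) (τ - σ) *
        (Real.sqrt (deriv A τ) - Real.sqrt (deriv A σ)) ^ 2| ≤
      2 * K ^ 2 * ξ ^ ((4 : ℝ) / 3) * |u - v| := by
  have hβd : Differentiable ℝ β := hsmooth.differentiable (by simp)
  have h1s : ContDiff ℝ 1 (deriv β) := by
    have h2 : ContDiff ℝ (1 + 1) β := hsmooth.of_le (by
      have : ((1 + 1 : ℕ∞) : WithTop ℕ∞) ≤ ((⊤ : ℕ∞) : WithTop ℕ∞) := by
        exact_mod_cast le_top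
      simpa using this)
    exact (contDiff_succ_iff_deriv.1 h2).2.2
  have hβ'd : Differentiable ℝ (deriv β) := h1s.differentiable (by simp)
  have hβ''c : Continuous (deriv (deriv β)) := h1s.continuous_deriv (by simp)
  have hξ0 : ξ ≠ 0 := hξ.ne'
  have hdiv : ∀ r : ℝ, HasDerivAt (fun r : ℝ => r / ξ) (1 / ξ) r := fun r =>
    (hasDerivAt_id r).div_const ξ
  have e1 : deriv (betaXi β ξ) = fun r => deriv β (r / ξ) := by
    funext r
    have h := (((hβd (r / ξ)).hasDerivAt).comp r (hdiv r)).const_mul ξ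
    have h' : HasDerivAt (betaXi β ξ) (ξ * (deriv β (r / ξ) * (1 / ξ))) r := h
    rw [h'.deriv]
    field_simp
  have hd2 : ∀ r, HasDerivAt (fun r => deriv β (r / ξ)) (deriv (deriv β) (r / ξ) * (1 / ξ)) r :=
    fun r => HasDerivAt.comp (h₂ := deriv β) r ((hβ'd (r / ξ)).hasDerivAt) (hdiv r)
  have e2 : deriv (deriv (betaXi β ξ)) = fun r => deriv (deriv β) (r / ξ) * (1 / ξ) := by
    funext r
    rw [e1, (hd2 r).deriv]
  have hz : ∀ r : ℝ, 1 < |r| → deriv (deriv β) r = 0 := by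
    intro r hr
    rcases lt_abs.1 hr with h | h
    · have : deriv β =ᶠ[nhds r] fun _ => (1 : ℝ) := by
        filter_upwards [lt_mem_nhds h] with x hx using hup x hx.le
      rw [this.deriv_eq]; simp
    · have : deriv β =ᶠ[nhds r] fun _ => (-1 : ℝ) := by
        filter_upwards [gt_mem_nhds (show r < -1 by linarith)] with x hx using hdown x hx.le
      rw [this.deriv_eq]; simp
  rw [e2]
  set C : ℝ := K ^ 2 * ξ ^ ((4 : ℝ) / 3) with hC
  have hC0 : 0 ≤ C := by positivity
  have hpt : ∀ σ τ : ℝ, ‖deriv (deriv β) ((τ - σ) / ξ) * (1 / ξ) *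
      (Real.sqrt (deriv A τ) - Real.sqrt (deriv A σ)) ^ 2‖ ≤
      deriv (deriv β) ((τ - σ) / ξ) * (1 / ξ) * C := by
    intro σ τ
    have hb := hconv ((τ - σ) / ξ)
    rw [Real.norm_of_nonneg (by positivity)]
    by_cases h : 1 < |(τ - σ) / ξ|
    · rw [hz _ h]; simp
    · have hle : |τ - σ| ≤ ξ := by
        rw [abs_div, abs_of_pos hξ, not_lt, div_le_one hξ] at h
        exact h
      apply mul_le_mul_of_nonneg_left _ (by positivity)
      have h1 : |Real.sqrt (deriv A τ) - Real.sqrt (deriv A σ)| ≤ K * ξ ^ ((2 : ℝ) / 3) :=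
        (hmod τ σ).trans (by gcongr)
      have h2 : (ξ ^ ((2 : ℝ) / 3)) ^ 2 = ξ ^ ((4 : ℝ) / 3) := by
        rw [← Real.rpow_natCast, ← Real.rpow_mul hξ.le]; norm_num
      rw [hC, ← h2, ← mul_pow, ← sq_abs]
      gcongr
  have hin : ∀ σ : ℝ, ‖∫ τ in σ..u, deriv (deriv β) ((τ - σ) / ξ) * (1 / ξ) *
      (Real.sqrt (deriv A τ) - Real.sqrt (deriv A σ)) ^ 2‖ ≤ 2 * C := by
    intro σ
    have hcont : Continuous fun τ => deriv (deriv β) ((τ - σ) / ξ) * (1 / ξ) * C := by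
      fun_prop
    refine (intervalIntegral.norm_integral_le_abs_of_norm_le
      (Filter.Eventually.of_forall fun τ => hpt σ τ) (hcont.intervalIntegrable _ _)).trans ?_
    have hD : ∀ τ, HasDerivAt (fun τ => deriv β ((τ - σ) / ξ) * C)
        (deriv (deriv β) ((τ - σ) / ξ) * (1 / ξ) * C) τ := by
      intro τ
      have := (hd2 (τ - σ)).comp_sub_const τ σ
      exact this.mul_const C
    rw [intervalIntegral.integral_eq_sub_of_hasDerivAt (fun τ _ => hD τ)
      (hcont.intervalIntegrable _ _), ← sub_mul, abs_mul, abs_of_nonneg hC0]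
    gcongr
    have a1 := abs_le.1 (hd1 ((u - σ) / ξ))
    have a2 := abs_le.1 (hd1 ((σ - σ) / ξ))
    rw [abs_le]
    constructor <;> linarith
  have := intervalIntegral.norm_integral_le_of_norm_le_const (a := u) (b := v)
    (fun σ _ => hin σ)
  rw [Real.norm_eq_abs, abs_sub_comm v u] at this
  rw [mul_assoc 2 (K ^ 2)]
  exact this
end

section
/- Let β : ℝ → ℝ be a twice continuously differentiable, even, non-negative, convex function with β(0) = 0 whose second derivative β'' is non-increasing on [0, ∞). Let λ* ∈ (0,1), let z, u, η ∈ ℝ satisfy |η| ≤ λ* |u| (|z| ∧ 1). Then for every λ ∈ [0,1], η² β''(u + λ η) ≤ 4 (1 ∧ |z|²) · (λ*)² (1 + λ*)² / (1 − λ λ*)² · β(u). -/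
theorem aux_quad (β : ℝ → ℝ) (hC2 : ContDiff ℝ 2 β) (heven : ∀ r, β (-r) = β r)
    (h0 : β 0 = 0) (hanti : AntitoneOn (deriv (deriv β)) (Set.Ici 0)) (w : ℝ) (hw : 0 < w) :
    w ^ 2 * deriv (deriv β) w ≤ 2 * β w := by
  have hd : Differentiable ℝ β := hC2.differentiable (by norm_num)
  have hC1 : ContDiff ℝ 1 (deriv β) := by
    have h : ContDiff ℝ (1 + 1) β := by
      convert hC2 using 1
      norm_num
    exact (contDiff_succ_iff_deriv.1 h).2.2
  have hdd : Differentiable ℝ (deriv β) := hC1.differentiable (by norm_num)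
  have hd0 : deriv β 0 = 0 := by
    have h1 : (fun x => β (-x)) = β := funext heven
    have h2 := deriv_comp_neg β 0
    rw [h1, neg_zero] at h2
    linarith
  set c := deriv (deriv β) w with hc
  have hg1 : ∀ x, HasDerivAt (fun x => deriv β x - c * x) (deriv (deriv β) x - c) x := by
    intro x
    exact ((hdd x).hasDerivAt.sub ((hasDerivAt_id x).const_mul c)).congr_deriv (by simp)
  have hg0 : ∀ x, HasDerivAt (fun x => β x - c * x ^ 2 / 2) (deriv β x - c * x) x := by
    intro x
    have := (hd x).hasDerivAt.sub ((((hasDerivAt_id x).pow 2).const_mul c).div_const 2)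
    exact this.congr_deriv (by simp; ring)
  have m1 : MonotoneOn (fun x => deriv β x - c * x) (Set.Icc 0 w) := by
    apply monotoneOn_of_deriv_nonneg (convex_Icc 0 w)
    · exact fun x _ => (hg1 x).continuousAt.continuousWithinAt
    · exact fun x _ => (hg1 x).differentiableAt.differentiableWithinAt
    · intro x hx
      rw [interior_Icc] at hx
      rw [(hg1 x).deriv]
      have := hanti (Set.mem_Ici.2 hx.1.le) (Set.mem_Ici.2 hw.le) hx.2.le
      linarith
  have m0 : MonotoneOn (fun x => β x - c * x ^ 2 / 2) (Set.Icc 0 w) := by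
    apply monotoneOn_of_deriv_nonneg (convex_Icc 0 w)
    · exact fun x _ => (hg0 x).continuousAt.continuousWithinAt
    · exact fun x _ => (hg0 x).differentiableAt.differentiableWithinAt
    · intro x hx
      rw [interior_Icc] at hx
      rw [(hg0 x).deriv]
      have := m1 (Set.left_mem_Icc.2 hw.le) ⟨hx.1.le, hx.2.le⟩ hx.1.le
      simp only [hd0] at this
      linarith
  have := m0 (Set.left_mem_Icc.2 hw.le) (Set.right_mem_Icc.2 hw.le) hw.le
  simp only [h0] at this
  linarith

theorem aux_even (β : ℝ → ℝ) (heven : ∀ r, β (-r) = β r) (x : ℝ) :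
    deriv (deriv β) |x| = deriv (deriv β) x := by
  have h1 : (fun x => β (-x)) = β := funext heven
  have h2 : ∀ y, deriv β (-y) = - deriv β y := by
    intro y
    have := deriv_comp_neg β y
    rw [h1] at this
    linarith
  have h3 : ∀ y, deriv (deriv β) (-y) = deriv (deriv β) y := by
    intro y
    have := deriv_comp_neg (deriv β) y
    rw [funext h2, deriv.fun_neg] at this
    linarith
  rcases abs_choice x with h | h <;> rw [h]
  exact h3 x


/-- Let `β : ℝ → ℝ` be a twice continuously differentiable, even,
non-negative, convex function with `β 0 = 0` whose second derivative is non-increasing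
on `[0, ∞)`. Let `λ* ∈ (0,1)` and let `z, u, η ∈ ℝ` satisfy `|η| ≤ λ* |u| (|z| ∧ 1)`.
Then for every `λ ∈ [0,1]`,
`η² β''(u + λ η) ≤ 4 (1 ∧ |z|²) (λ*)² (1 + λ*)² / (1 − λ λ*)² · β(u)`. -/
theorem stmt_12 (β : ℝ → ℝ) (hC2 : ContDiff ℝ 2 β) (heven : ∀ r, β (-r) = β r)
    (hnonneg : ∀ r, 0 ≤ β r) (hconv : ConvexOn ℝ Set.univ β) (h0 : β 0 = 0)
    (hanti : AntitoneOn (deriv (deriv β)) (Set.Ici 0))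
    (lam : ℝ) (hlam : lam ∈ Set.Ioo (0 : ℝ) 1)
    (z u η : ℝ) (hη : |η| ≤ lam * |u| * min |z| 1) :
    ∀ l ∈ Set.Icc (0 : ℝ) 1,
      η ^ 2 * deriv (deriv β) (u + l * η) ≤
        4 * min 1 (|z| ^ 2) * lam ^ 2 * (1 + lam) ^ 2 / (1 - l * lam) ^ 2 * β u := by
  rintro l ⟨hl0, hl1⟩
  obtain ⟨hp, hq⟩ := hlam
  have ha : 0 < 1 - l * lam := by nlinarith
  set a := 1 - l * lam with hadef
  have ha1 : a ≤ 1 := by nlinarith [mul_nonneg hl0 hp.le]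
  set m := min |z| 1 with hm
  have hm0 : 0 ≤ m := le_min (abs_nonneg _) zero_le_one
  have hm1 : m ≤ 1 := min_le_right _ _
  have hmm : min 1 (|z| ^ 2) = m ^ 2 := by
    rcases le_total |z| 1 with h | h
    · rw [hm, min_eq_left h, min_eq_right]
      nlinarith [abs_nonneg z]
    · rw [hm, min_eq_right h, min_eq_left]
      · norm_num
      · nlinarith
  rw [hmm]
  rcases eq_or_ne u 0 with hu | hu
  · have : η = 0 := by
      rw [hu] at hη
      simpa using hη
    rw [this, hu, h0]
    simp
  have hu' : 0 < |u| := abs_pos.2 hu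
  have hw : 0 < a * |u| := mul_pos ha hu'
  have hv : a * |u| ≤ |u + l * η| := by
    have h1 : |u| ≤ |u + l * η| + |l * η| := by
      have := abs_sub (u + l * η) (l * η)
      simpa using this
    rw [abs_mul, abs_of_nonneg hl0] at h1
    have h2 : |η| ≤ lam * |u| :=
      hη.trans (mul_le_of_le_one_right (by positivity) hm1)
    have h3 := mul_le_mul_of_nonneg_left h2 hl0
    rw [hadef]
    linarith
  have h1 : deriv (deriv β) (u + l * η) ≤ deriv (deriv β) (a * |u|) := by
    rw [← aux_even β heven (u + l * η)]
    exact hanti (Set.mem_Ici.2 hw.le) (Set.mem_Ici.2 (abs_nonneg _)) hv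
  have h2 := aux_quad β hC2 heven h0 hanti _ hw
  have hbu : β |u| = β u := by
    rcases abs_choice u with h | h <;> rw [h]
    exact heven u
  have h3 : β (a * |u|) ≤ β u := by
    have := hconv.2 (Set.mem_univ |u|) (Set.mem_univ 0) ha.le (sub_nonneg.2 ha1) (by ring)
    simp only [smul_eq_mul, mul_zero, add_zero, h0, hbu] at this
    exact this.trans (mul_le_of_le_one_left (hnonneg u) ha1)
  have h4 : deriv (deriv β) (u + l * η) ≤ 2 * β u / (a * |u|) ^ 2 := by
    rw [le_div_iff₀ (by positivity)]
    have := mul_le_mul_of_nonneg_left h1 (sq_nonneg (a * |u|))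
    linarith
  have h5 : η ^ 2 ≤ (lam * |u| * m) ^ 2 := by
    rw [← sq_abs η]
    exact pow_le_pow_left₀ (abs_nonneg _) hη 2
  have hb := hnonneg u
  calc η ^ 2 * deriv (deriv β) (u + l * η) ≤ η ^ 2 * (2 * β u / (a * |u|) ^ 2) :=
        mul_le_mul_of_nonneg_left h4 (sq_nonneg _)
    _ ≤ (lam * |u| * m) ^ 2 * (2 * β u / (a * |u|) ^ 2) :=
        mul_le_mul_of_nonneg_right h5 (by positivity)
    _ = (m ^ 2 * lam ^ 2 / a ^ 2 * β u) * 2 := by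
        field_simp
    _ ≤ (m ^ 2 * lam ^ 2 / a ^ 2 * β u) * (4 * (1 + lam) ^ 2) :=
        mul_le_mul_of_nonneg_left (by nlinarith) (by positivity)
    _ = 4 * m ^ 2 * lam ^ 2 * (1 + lam) ^ 2 / a ^ 2 * β u := by ring
end
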